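/- Define N : ℕ × ℕ → ℕ recursively by N(n,1) = 3^n and N(n,k+1) = 3^{N(n,k)}. Then for all natural numbers n and all k ≥ 1, this value N(n,k) witnesses the combinatorial selection lemma: for every indexed family (f_i^j)_{i ∈ I, j < k} of functions f_i^j : ℕ → {0,1,2} with |I| = N(n,k), and every m ∈ ℕ such that {f_i^j↾l : i ∈ I, j < k, l ≤ m} is a 2-tree and such that whenever j ≠ t and f_i^j↾m = f_s^t↾m then f_i^j = f_s^t, there exists S ⊆ I with |S| = n such that {f_i^j↾l : i ∈ S, j < k, l ∈ ℕ} is a 2-tree. -/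

import Mathlib

/-- A tree: a set of finite sequences of naturals closed under initial segments. -/
def IsTree (T : Set (List ℕ)) : Prop :=
  ∀ σ ∈ T, ∀ n : ℕ, σ.take n ∈ T

/-- The immediate successors of a node `σ` within `T`. -/
def succs (T : Set (List ℕ)) (σ : List ℕ) : Set ℕ :=
  {m : ℕ | σ ++ [m] ∈ T}

/-- The set of all initial segments of a family of functions is a `k`-tree:
it is a tree (closed under initial segments) and every element has at most
`k` immediate successors within the set. -/
def IsInitSegKTree (k : ℕ) (T : Set (List ℕ)) : Prop :=
  IsTree T ∧ ∀ σ ∈ T, (succs T σ).encard ≤ k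

/-- The initial segment `f↾n = ⟨f 0, …, f (n-1)⟩`. -/
def seg (f : ℕ → ℕ) (n : ℕ) : List ℕ :=
  List.ofFn fun i : Fin n => f i

/-- `NN n k` is the number recursively defined by `N(n,1) = 3 ^ n` and
`N(n,k+1) = 3 ^ N(n,k)`.  (The anchor value `NN n 0 = n` makes the
recurrence `NN n (k+1) = 3 ^ NN n k` reproduce exactly these equations.) -/
def NN (n : ℕ) : ℕ → ℕ
  | 0 => n
  | k + 1 => 3 ^ NN n k

theorem seg_eq_map_range (f : ℕ → ℕ) (n : ℕ) : seg f n = (List.range n).map f := by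
  simp [seg, List.ext_get_iff]

theorem length_seg (f : ℕ → ℕ) (n : ℕ) : (seg f n).length = n := by
  simp [seg]

theorem seg_succ (f : ℕ → ℕ) (n : ℕ) : seg f (n + 1) = seg f n ++ [f n] := by
  simp [seg_eq_map_range, List.range_succ]

theorem take_seg (f : ℕ → ℕ) (n l : ℕ) : (seg f l).take n = seg f (min n l) := by
  simp [seg_eq_map_range, ← List.map_take, List.take_range]

theorem seg_eq_seg_iff {f g : ℕ → ℕ} {n : ℕ} :
    seg f n = seg g n ↔ ∀ p < n, f p = g p := by
  simp [seg_eq_map_range]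

theorem seg_append_singleton_eq {f g : ℕ → ℕ} {l l' x : ℕ}
    (h : seg f l ++ [x] = seg g l') : l' = l + 1 ∧ seg f l = seg g l ∧ x = g l := by
  have hl : l' = l + 1 := by simpa [length_seg] using (congrArg List.length h).symm
  subst hl
  rw [seg_succ] at h
  simpa using List.append_inj' h rfl

/-- The functions `g a`, `a ∈ S`, never split into three or more directions at a node. -/
def IsBinaryOn {I : Type*} (g : I → ℕ → ℕ) (S : Finset I) : Prop :=
  ∀ a ∈ S, ∀ b ∈ S, ∀ c ∈ S, ∀ l, seg (g a) l = seg (g b) l → seg (g a) l = seg (g c) l →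
    g a l = g b l ∨ g a l = g c l ∨ g b l = g c l

theorem IsBinaryOn.mono {I : Type*} {g : I → ℕ → ℕ} {S T : Finset I}
    (h : IsBinaryOn g S) (hTS : T ⊆ S) : IsBinaryOn g T :=
  fun a ha b hb c hc => h a (hTS ha) b (hTS hb) c (hTS hc)

/-- Adding to a binary family one function which leaves it at a node common to all the
functions keeps the family binary. -/
theorem IsBinaryOn.insert {I : Type*} [DecidableEq I] {g : I → ℕ → ℕ} {T : Finset I}
    (hT : IsBinaryOn g T) {b : I} {l v : ℕ} (hbl : g b l ≠ v) (hTl : ∀ a ∈ T, g a l = v)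
    (hagree : ∀ a ∈ T, ∀ p < l, g a p = g b p) : IsBinaryOn g (insert b T) := by
  have key : ∀ x ∈ T, ∀ y ∈ T, ∀ q, (∀ p < q, g x p = g b p) →
      g x q = g b q ∨ g x q = g y q := by
    intro x hx y hy q h
    rcases lt_trichotomy q l with hq | rfl | hq
    · exact Or.inl (hagree x hx q hq)
    · exact Or.inr ((hTl x hx).trans (hTl y hy).symm)
    · exact absurd ((h l hq).symm.trans (hTl x hx)) hbl
  intro x hx y hy z hz q hxy hxz
  rw [Finset.mem_insert] at hx hy hz
  have hxy' := seg_eq_seg_iff.1 hxy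
  have hxz' := seg_eq_seg_iff.1 hxz
  rcases hx with rfl | hx <;> rcases hy with rfl | hy <;> rcases hz with rfl | hz
  · simp
  · simp
  · simp
  · have := key y hy z hz q fun p hp => (hxy' p hp).symm
    tauto
  · simp
  · have := key x hx z hz q hxy'
    tauto
  · have := key x hx y hy q hxz'
    tauto
  · exact hT x hx y hy z hz q hxy hxz

/-- Among `3 ^ n` functions `ℕ → {0, 1, 2}` there are `n` that form a binary family. -/
theorem exists_isBinaryOn {I : Type*} (g : I → ℕ → ℕ) (hg : ∀ i p, g i p < 3) (n : ℕ) :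
    ∀ S : Finset I, 3 ^ n ≤ S.card → ∃ T ⊆ S, T.card = n ∧ IsBinaryOn g T := by
  classical
  induction n with
  | zero => exact fun S _ => ⟨∅, by simp, by simp, by simp [IsBinaryOn]⟩
  | succ n ih =>
    intro S hS
    by_cases hall : ∃ l, ∃ a ∈ S, ∃ b ∈ S, g a l ≠ g b l
    · obtain ⟨a₀, ha₀, b₀, hb₀, hab⟩ := Nat.find_spec hall
      have hmin : ∀ p < Nat.find hall, ∀ a ∈ S, ∀ b ∈ S, g a p = g b p := by
        intro p hp a ha b hb
        by_contra hne
        exact Nat.find_min hall hp ⟨a, ha, b, hb, hne⟩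
      generalize Nat.find hall = l at hab hmin
      obtain ⟨v, -, hv⟩ := Finset.exists_le_card_fiber_of_mul_le_card_of_maps_to
        (s := S) (t := Finset.range 3) (f := fun i => g i l) (n := 3 ^ n)
        (fun i _ => Finset.mem_range.2 (hg i l)) ⟨0, by simp⟩ (by simpa [pow_succ'] using hS)
      obtain ⟨T, hTS, hTn, hT⟩ := ih _ hv
      have hTl : ∀ a ∈ T, g a l = v := fun a ha => (Finset.mem_filter.1 (hTS ha)).2
      have hTS' : T ⊆ S := hTS.trans (Finset.filter_subset _ _)
      obtain ⟨b, hb, hbl⟩ : ∃ b ∈ S, g b l ≠ v := by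
        by_cases h : g a₀ l = v
        · exact ⟨b₀, hb₀, fun h' => hab (h.trans h'.symm)⟩
        · exact ⟨a₀, ha₀, h⟩
      refine ⟨insert b T, Finset.insert_subset hb hTS', ?_,
        hT.insert hbl hTl fun a ha p hp => hmin p hp a (hTS' ha) b hb⟩
      rw [Finset.card_insert_of_notMem fun hbT => hbl (hTl b hbT), hTn]
    · push Not at hall
      obtain ⟨T, hTS, hTn⟩ := Finset.exists_subset_card_eq
        ((Nat.lt_pow_self (by norm_num : 1 < 3)).le.trans hS)
      exact ⟨T, hTS, hTn, fun a ha b hb _ _ l _ _ => Or.inl (hall l a (hTS ha) b (hTS hb))⟩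

theorem exists_forall_isBinaryOn {I ι : Type*} (f : I → ι → ℕ → ℕ)
    (hf : ∀ i j p, f i j p < 3) (n : ℕ) (J : Finset ι) :
    ∀ S : Finset I, NN n J.card ≤ S.card →
      ∃ T ⊆ S, T.card = n ∧ ∀ j ∈ J, IsBinaryOn (fun i => f i j) T := by
  classical
  induction J using Finset.induction_on with
  | empty =>
    intro S hS
    obtain ⟨T, hTS, hTn⟩ := Finset.exists_subset_card_eq hS
    exact ⟨T, hTS, by simpa [NN] using hTn, by simp⟩
  | insert j J hj ih =>
    intro S hS
    rw [Finset.card_insert_of_notMem hj] at hS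
    obtain ⟨U, hUS, hUn, hU⟩ := exists_isBinaryOn (fun i => f i j) (fun i => hf i j) _ S hS
    obtain ⟨T, hTU, hTn, hT⟩ := ih U hUn.ge
    refine ⟨T, hTU.trans hUS, hTn, fun t ht => ?_⟩
    rcases Finset.mem_insert.1 ht with rfl | ht
    · exact hU.mono hTU
    · exact hT t ht

theorem stmt3 (n k : ℕ) (hk : 1 ≤ k) :
    ∀ (I : Type) [Fintype I], Fintype.card I = NN n k →
      ∀ f : I → Fin k → ℕ → ℕ, (∀ i j m, f i j m < 3) →
      ∀ m : ℕ,
        IsInitSegKTree 2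
          {σ : List ℕ | ∃ i : I, ∃ j : Fin k, ∃ l ≤ m, σ = seg (f i j) l} →
        (∀ (i s : I) (j t : Fin k), j ≠ t →
          seg (f i j) m = seg (f s t) m → f i j = f s t) →
        ∃ S : Finset I, S.card = n ∧
          IsInitSegKTree 2
            {σ : List ℕ | ∃ i ∈ S, ∃ j : Fin k, ∃ l : ℕ, σ = seg (f i j) l} := by
  intro I _ hI f hf m htree hm
  obtain ⟨S, -, hSn, hS⟩ := exists_forall_isBinaryOn f hf n Finset.univ Finset.univ
    (by simp [hI])
  refine ⟨S, hSn, ?_, ?_⟩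
  · rintro _ ⟨i, hi, j, l, rfl⟩ q
    exact ⟨i, hi, j, _, take_seg _ _ _⟩
  rintro _ ⟨i, hi, j, l, rfl⟩
  rcases lt_or_ge l m with hl | hl
  · refine (Set.encard_le_encard ?_).trans (htree.2 _ ⟨i, j, l, hl.le, rfl⟩)
    rintro x ⟨s, -, t, l', h⟩
    obtain ⟨rfl, -, -⟩ := seg_append_singleton_eq h
    exact ⟨s, t, l + 1, hl, h⟩
  · by_contra! hlt
    obtain ⟨t, ht, htcard⟩ := Set.exists_subset_encard_eq (Order.add_one_le_of_lt hlt)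
    obtain ⟨x, y, z, hxy, hxz, hyz, rfl⟩ := Set.encard_eq_three.1
      (htcard.trans (by norm_num))
    obtain ⟨hx, hy, hz⟩ : x ∈ succs _ _ ∧ y ∈ succs _ _ ∧ z ∈ succs _ _ :=
      ⟨ht (by simp), ht (by simp), ht (by simp)⟩
    obtain ⟨a, ha, u, _, hx⟩ := hx
    obtain ⟨b, hb, v, _, hy⟩ := hy
    obtain ⟨c, hc, w, _, hz⟩ := hz
    obtain ⟨-, hsega, rfl⟩ := seg_append_singleton_eq hx
    obtain ⟨-, hsegb, rfl⟩ := seg_append_singleton_eq hy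
    obtain ⟨-, hsegc, rfl⟩ := seg_append_singleton_eq hz
    have same : ∀ {p q : I} {r t : Fin k}, seg (f p r) l = seg (f q t) l →
        f p r l ≠ f q t l → r = t := by
      intro p q r t h hne
      by_contra hrt
      refine hne (congrFun (hm p q r t hrt (seg_eq_seg_iff.2 fun s hs => ?_)) l)
      exact seg_eq_seg_iff.1 h s (hs.trans_le hl)
    have hab := hsega.symm.trans hsegb
    have hac := hsega.symm.trans hsegc
    obtain rfl := same hab hxy
    obtain rfl := same hac hxz
    rcases hS u (Finset.mem_univ u) a ha b hb c hc l hab hac with h | h | h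
    exacts [hxy h, hxz h, hyz h]
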